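/- Every planar graph is 5-colourable (the Five Colour Theorem); in particular any finite simple planar graph admits a proper vertex colouring with 5 colours. -/

import Mathlib

open unitInterval in
/-- The interior of an arc: its image minus the endpoints' parameters. -/
def ArcInterior {x y : ℝ × ℝ} (γ : Path x y) : Set (ℝ × ℝ) :=
  γ '' {t : unitInterval | (t : ℝ) ≠ 0 ∧ (t : ℝ) ≠ 1}

/-- A simple graph is planar if it has a topological embedding in the plane:
an injective placement of the vertices together with, for each edge, an
injective arc joining its endpoints, such that arcs meet vertices only at
their own endpoints and the interiors of arcs of distinct edges are
disjoint. -/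
def SimpleGraph.IsPlanar {V : Type*} (G : SimpleGraph V) : Prop :=
  ∃ (f : V → ℝ × ℝ) (γ : ∀ u v, G.Adj u v → _root_.Path (f u) (f v)),
    Function.Injective f ∧
    (∀ u v (h : G.Adj u v), Function.Injective (γ u v h)) ∧
    (∀ u v (h : G.Adj u v), ∀ w : V, f w ∈ Set.range (γ u v h) → w = u ∨ w = v) ∧
    (∀ u v a b (h₁ : G.Adj u v) (h₂ : G.Adj a b), s(u, v) ≠ s(a, b) →
      ArcInterior (γ u v h₁) ∩ ArcInterior (γ a b h₂) = ∅)


lemma FCT_exists_log (F : C(ℝ × ℝ, ℂ)) (h : ∀ x, F x ≠ 0) :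
    ∃ L : C(ℝ × ℝ, ℂ), ∀ x, Complex.exp (L x) = F x := by
  obtain ⟨L, ⟨-, hL⟩, -⟩ := Complex.isCoveringMapOn_exp.existsUnique_continuousMap_lifts F
    (a₀ := (0, 0)) (e₀ := Complex.log (F (0, 0))) (Complex.exp_log (h _)) (fun a => h a)
  exact ⟨L, fun x => congrFun hL x⟩

lemma FCT_log_unique (L M : ℝ → ℂ) (hL : Continuous L) (hM : Continuous M) (c : ℂ)
    (h : ∀ t, Complex.exp (L t) = c * Complex.exp (M t)) : L 1 - L 0 = M 1 - M 0 := by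
  have key : (fun t => L t - M t) = fun _ => L 0 - M 0 := by
    refine Complex.isCoveringMap_exp.eq_of_comp_eq (hL.sub hM) continuous_const ?_ 0 rfl
    funext t
    simp only [Function.comp, Subtype.mk.injEq, Complex.exp_sub, h]
    rw [mul_div_assoc, mul_div_assoc, div_self (Complex.exp_ne_zero _),
      div_self (Complex.exp_ne_zero _)]
  have : L 1 - M 1 = L 0 - M 0 := congrFun key 1
  linear_combination this

/-- Increment of a logarithm along the curve `g - z`. -/
lemma FCT_incr (g : ℝ → ℂ) (hg : Continuous g) (z : ℂ) (hz : ∀ t, g t ≠ z) :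
    ∃ D : ℂ, (∀ L : ℝ → ℂ, Continuous L →
      ((∀ t, Complex.exp (L t) = g t - z) ∨ (∀ t, Complex.exp (L t) = z - g t)) →
        L 1 - L 0 = D) ∧ Complex.exp D * (g 0 - z) = g 1 - z := by
  obtain ⟨M, hM⟩ := FCT_exists_log ⟨fun x => g x.1 - z, by fun_prop⟩
    (fun x => sub_ne_zero.2 (hz _))
  simp only [ContinuousMap.coe_mk] at hM
  refine ⟨M (1, 0) - M (0, 0), ?_, ?_⟩
  · intro L hL h
    rcases h with h | h
    · refine FCT_log_unique L (fun t => M (t, 0)) hL (by fun_prop) 1 ?_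
      intro t; rw [h, hM]; ring
    · refine FCT_log_unique L (fun t => M (t, 0)) hL (by fun_prop) (-1) ?_
      intro t; rw [h, hM]; ring
  · rw [Complex.exp_sub, hM, hM]
    exact div_mul_cancel₀ _ (sub_ne_zero.2 (hz _))

/-- **Van Kampen–Flores for `K₅`**: in any continuous drawing of `K₅` in the plane,
two independent edges meet. -/
lemma FCT_K5 (z : Fin 5 → ℂ) (g : Fin 5 → Fin 5 → ℝ → ℂ)
    (hc : ∀ i j, i < j → Continuous (g i j))
    (h0 : ∀ i j, i < j → g i j 0 = z i) (h1 : ∀ i j, i < j → g i j 1 = z j)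
    (hd : ∀ i j k l, i < j → k < l → i ≠ k → i ≠ l → j ≠ k → j ≠ l →
      ∀ s t, g i j s ≠ g k l t) : False := by
  have hv : ∀ i j k, i < j → k ≠ i → k ≠ j → ∀ t, g i j t ≠ z k := by
    intro i j k hij hki hkj t
    obtain ⟨l, hli, hlj, hlk⟩ : ∃ l : Fin 5, l ≠ i ∧ l ≠ j ∧ l ≠ k := by
      revert i j k; decide
    rcases lt_or_gt_of_ne hlk with h | h
    · rw [← h1 l k h]; exact hd i j l k hij h hli.symm hki.symm hlj.symm hkj.symm _ _
    · rw [← h0 k l h]; exact hd i j k l hij h hki.symm hli.symm hkj.symm hlj.symm _ _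
  have hz : ∀ i j, i ≠ j → z i - z j ≠ 0 := by
    intro i j hij
    obtain ⟨l, hli, hlj⟩ : ∃ l : Fin 5, l ≠ i ∧ l ≠ j := by revert i j; decide
    rw [sub_ne_zero]
    rcases lt_or_gt_of_ne hli with h | h
    · rw [← h1 l i h]; exact hv _ _ _ h hlj.symm hij.symm _
    · rw [← h0 i l h]; exact hv _ _ _ h hij.symm hlj.symm _
  have hD : ∀ i j k, ∃ D : ℂ, i < j → k ≠ i → k ≠ j → (∀ L : ℝ → ℂ, Continuous L →
      ((∀ t, Complex.exp (L t) = g i j t - z k) ∨ (∀ t, Complex.exp (L t) = z k - g i j t)) →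
        L 1 - L 0 = D) ∧ Complex.exp D * (z i - z k) = z j - z k := by
    intro i j k
    by_cases h : i < j ∧ k ≠ i ∧ k ≠ j
    · obtain ⟨D, hD⟩ := FCT_incr (g i j) (hc i j h.1) (z k) (hv i j k h.1 h.2.1 h.2.2)
      rw [h0 i j h.1, h1 i j h.1] at hD
      exact ⟨D, fun _ _ _ => hD⟩
    · exact ⟨0, fun a b c => absurd ⟨a, b, c⟩ h⟩
  choose D hD using hD
  -- squares
  have sq : ∀ i j k l, i < j → k < l → i ≠ k → i ≠ l → j ≠ k → j ≠ l →
      D i j k + D k l j = D k l i + D i j l := by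
    intro i j k l hij hkl hik hil hjk hjl
    have c1 := hc i j hij
    have c2 := hc k l hkl
    obtain ⟨L, hL⟩ := FCT_exists_log ⟨fun x => g i j x.1 - g k l x.2, by fun_prop⟩
      (fun x => sub_ne_zero.2 (hd i j k l hij hkl hik hil hjk hjl _ _))
    simp only [ContinuousMap.coe_mk] at hL
    have e1 := (hD i j k hij hik.symm hjk.symm).1 (fun t => L (t, 0)) (by fun_prop)
      (Or.inl fun t => by rw [hL, h0 k l hkl])
    have e2 := (hD i j l hij hil.symm hjl.symm).1 (fun t => L (t, 1)) (by fun_prop)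
      (Or.inl fun t => by rw [hL, h1 k l hkl])
    have e3 := (hD k l i hkl hik hil).1 (fun t => L (0, t)) (by fun_prop)
      (Or.inr fun t => by rw [hL, h0 i j hij])
    have e4 := (hD k l j hkl hjk hjl).1 (fun t => L (1, t)) (by fun_prop)
      (Or.inr fun t => by rw [hL, h1 i j hij])
    rw [← e1, ← e2, ← e3, ← e4]; ring
  let ℓ : Fin 5 → Fin 5 → ℂ := fun j k =>
    if j < k then Complex.log (z j - z k) else Complex.log (z k - z j) + Real.pi * Complex.I
  have hℓ : ∀ j k, j ≠ k → Complex.exp (ℓ j k) = z j - z k := by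
    intro j k hjk
    simp only [ℓ]
    split_ifs
    · exact Complex.exp_log (hz _ _ hjk)
    · rw [Complex.exp_add, Complex.exp_log (hz _ _ hjk.symm), Complex.exp_pi_mul_I]; ring
  let s : Fin 5 → Fin 5 → ℤ := fun j k => if j < k then -1 else 1
  have hs : ∀ j k, j ≠ k → ℓ j k - ℓ k j = (s j k) * (Real.pi * Complex.I) := by
    intro j k hjk
    rcases lt_or_gt_of_ne hjk with h | h
    · simp only [ℓ, s, if_pos h, if_neg h.asymm]; push_cast; ring
    · simp only [ℓ, s, if_pos h, if_neg h.asymm]; push_cast; ring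
  have hn : ∀ i j k, ∃ n : ℤ, i < j → k ≠ i → k ≠ j →
      D i j k = ℓ j k - ℓ i k + n * (2 * Real.pi * Complex.I) := by
    intro i j k
    by_cases h : i < j ∧ k ≠ i ∧ k ≠ j
    · have e := (hD i j k h.1 h.2.1 h.2.2).2
      rw [← hℓ _ _ h.2.1.symm, ← hℓ _ _ h.2.2.symm, ← Complex.exp_add,
        Complex.exp_eq_exp_iff_exists_int] at e
      obtain ⟨n, hn⟩ := e
      exact ⟨n, fun _ _ _ => by linear_combination hn⟩
    · exact ⟨0, fun a b c => absurd ⟨a, b, c⟩ h⟩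
  choose n hn using hn
  have fin : ∀ i j k l, i < j → k < l → i ≠ k → i ≠ l → j ≠ k → j ≠ l →
      s j k - s i k - s j l + s i l + 2 * (n i j k + n k l j - n k l i - n i j l) = 0 := by
    intro i j k l hij hkl hik hil hjk hjl
    have e := sq i j k l hij hkl hik hil hjk hjl
    rw [hn i j k hij hik.symm hjk.symm, hn i j l hij hil.symm hjl.symm, hn k l i hkl hik hil,
      hn k l j hkl hjk hjl] at e
    have hpi : (Real.pi * Complex.I : ℂ) ≠ 0 := by simp [Real.pi_ne_zero]
    have e2 : ((s j k - s i k - s j l + s i l + 2 * (n i j k + n k l j - n k l i - n i j l) : ℤ) : ℂ)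
        * (Real.pi * Complex.I) = 0 := by
      push_cast
      linear_combination e - hs j k hjk + hs i k hik + hs j l hjl - hs i l hil
    exact_mod_cast (mul_eq_zero.1 e2).resolve_right hpi
  have q1 := fin 0 1 2 3 (by decide) (by decide) (by decide) (by decide) (by decide) (by decide)
  have q2 := fin 0 2 1 3 (by decide) (by decide) (by decide) (by decide) (by decide) (by decide)
  have q3 := fin 0 3 1 2 (by decide) (by decide) (by decide) (by decide) (by decide) (by decide)
  have q4 := fin 0 1 2 4 (by decide) (by decide) (by decide) (by decide) (by decide) (by decide)
  have q5 := fin 0 2 1 4 (by decide) (by decide) (by decide) (by decide) (by decide) (by decide)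
  have q6 := fin 0 4 1 2 (by decide) (by decide) (by decide) (by decide) (by decide) (by decide)
  have q7 := fin 0 1 3 4 (by decide) (by decide) (by decide) (by decide) (by decide) (by decide)
  have q8 := fin 0 3 1 4 (by decide) (by decide) (by decide) (by decide) (by decide) (by decide)
  have q9 := fin 0 4 1 3 (by decide) (by decide) (by decide) (by decide) (by decide) (by decide)
  have q10 := fin 0 2 3 4 (by decide) (by decide) (by decide) (by decide) (by decide) (by decide)
  have q11 := fin 0 3 2 4 (by decide) (by decide) (by decide) (by decide) (by decide) (by decide)
  have q12 := fin 0 4 2 3 (by decide) (by decide) (by decide) (by decide) (by decide) (by decide)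
  have q13 := fin 1 2 3 4 (by decide) (by decide) (by decide) (by decide) (by decide) (by decide)
  have q14 := fin 1 3 2 4 (by decide) (by decide) (by decide) (by decide) (by decide) (by decide)
  have q15 := fin 1 4 2 3 (by decide) (by decide) (by decide) (by decide) (by decide) (by decide)
  have s1 : ∀ a b : Fin 5, a < b → s a b = -1 := fun a b h => if_pos h
  have s2 : ∀ a b : Fin 5, b < a → s a b = 1 := fun a b h => if_neg h.asymm
  rw [s1 0 2 (by decide), s1 0 3 (by decide), s1 1 2 (by decide), s1 1 3 (by decide)] at q1
  rw [s1 0 1 (by decide), s1 0 3 (by decide), s2 2 1 (by decide), s1 2 3 (by decide)] at q2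
  rw [s1 0 1 (by decide), s1 0 2 (by decide), s2 3 1 (by decide), s2 3 2 (by decide)] at q3
  rw [s1 0 2 (by decide), s1 0 4 (by decide), s1 1 2 (by decide), s1 1 4 (by decide)] at q4
  rw [s1 0 1 (by decide), s1 0 4 (by decide), s2 2 1 (by decide), s1 2 4 (by decide)] at q5
  rw [s1 0 1 (by decide), s1 0 2 (by decide), s2 4 1 (by decide), s2 4 2 (by decide)] at q6
  rw [s1 0 3 (by decide), s1 0 4 (by decide), s1 1 3 (by decide), s1 1 4 (by decide)] at q7
  rw [s1 0 1 (by decide), s1 0 4 (by decide), s2 3 1 (by decide), s1 3 4 (by decide)] at q8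
  rw [s1 0 1 (by decide), s1 0 3 (by decide), s2 4 1 (by decide), s2 4 3 (by decide)] at q9
  rw [s1 0 3 (by decide), s1 0 4 (by decide), s1 2 3 (by decide), s1 2 4 (by decide)] at q10
  rw [s1 0 2 (by decide), s1 0 4 (by decide), s2 3 2 (by decide), s1 3 4 (by decide)] at q11
  rw [s1 0 2 (by decide), s1 0 3 (by decide), s2 4 2 (by decide), s2 4 3 (by decide)] at q12
  rw [s1 1 3 (by decide), s1 1 4 (by decide), s1 2 3 (by decide), s1 2 4 (by decide)] at q13
  rw [s1 1 2 (by decide), s1 1 4 (by decide), s2 3 2 (by decide), s1 3 4 (by decide)] at q14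
  rw [s1 1 2 (by decide), s1 1 3 (by decide), s2 4 2 (by decide), s2 4 3 (by decide)] at q15
  clear_value s ℓ
  clear hs hℓ hD hn fin sq hv hz hd h0 h1 hc s1 s2
  lia

/-- A weak form of planarity: edges are drawn inside sets, and independent edges are disjoint. -/
def FCT_P {V : Type*} (G : SimpleGraph V) : Prop :=
  ∃ (p : V → ℂ) (A : V → V → Set ℂ),
    (∀ a b, G.Adj a b → JoinedIn (A a b) (p a) (p b)) ∧
    (∀ a b c d, G.Adj a b → G.Adj c d → a ≠ c → a ≠ d → b ≠ c → b ≠ d →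
      Disjoint (A a b) (A c d))

lemma FCT_P_mono {V : Type*} {G H : SimpleGraph V} (h : H ≤ G) (hG : FCT_P G) : FCT_P H := by
  obtain ⟨p, A, h1, h2⟩ := hG
  exact ⟨p, A, fun a b hab => h1 a b (h hab),
    fun a b c d hab hcd => h2 a b c d (h hab) (h hcd)⟩

lemma FCT_P_of_planar {V : Type*} (G : SimpleGraph V) (hG : G.IsPlanar) : FCT_P G := by
  obtain ⟨f, γ, hf, hinj, hv, hdis⟩ := hG
  let φ : ℝ × ℝ → ℂ := Complex.equivRealProdCLM.symm
  have hφ : Continuous φ := Complex.equivRealProdCLM.symm.continuous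
  have hφi : Function.Injective φ := Complex.equivRealProdCLM.symm.injective
  refine ⟨fun v => φ (f v), fun a b => {w | ∃ h : G.Adj a b, w ∈ φ '' Set.range (γ a b h)},
    ?_, ?_⟩
  · intro a b h
    refine ⟨(γ a b h).map hφ, fun t => ⟨h, ?_⟩⟩
    exact ⟨γ a b h t, ⟨t, rfl⟩, rfl⟩
  · intro a b c d hab hcd hac had hbc hbd
    rw [Set.disjoint_left]
    rintro w ⟨h, _, ⟨s, rfl⟩, rfl⟩ ⟨h', _, ⟨t, rfl⟩, hst⟩
    have hst := hφi hst
    have hs0 : (s : ℝ) ≠ 0 := by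
      intro e
      have e : s = 0 := Subtype.ext e
      rw [e, Path.source] at hst
      rcases hv c d h' a ⟨t, hst⟩ with h | h <;> contradiction
    have hs1 : (s : ℝ) ≠ 1 := by
      intro e
      have e : s = 1 := Subtype.ext e
      rw [e, Path.target] at hst
      rcases hv c d h' b ⟨t, hst⟩ with h | h <;> contradiction
    have ht0 : (t : ℝ) ≠ 0 := by
      intro e
      have e : t = 0 := Subtype.ext e
      rw [e, Path.source] at hst
      rcases hv a b h c ⟨s, hst.symm⟩ with h | h <;> [exact hac h.symm; exact hbc h.symm]
    have ht1 : (t : ℝ) ≠ 1 := by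
      intro e
      have e : t = 1 := Subtype.ext e
      rw [e, Path.target] at hst
      rcases hv a b h d ⟨s, hst.symm⟩ with h | h <;> [exact had h.symm; exact hbd h.symm]
    have hne : s(a, b) ≠ s(c, d) := by
      intro e
      rcases Sym2.eq_iff.1 e with h | h
      · exact hac h.1
      · exact had h.1
    have := hdis a b c d h h' hne
    have hm : γ a b h s ∈ ArcInterior (γ a b h) ∩ ArcInterior (γ c d h') :=
      ⟨⟨s, ⟨hs0, hs1⟩, rfl⟩, ⟨t, ⟨ht0, ht1⟩, hst⟩⟩
    rw [this] at hm
    exact hm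

lemma FCT_no_K5 {V : Type*} {G : SimpleGraph V} (hG : FCT_P G) (K : Finset V)
    (hK : K.card = 5) (hadj : ∀ a ∈ K, ∀ b ∈ K, a ≠ b → G.Adj a b) : False := by
  obtain ⟨p, A, h1, h2⟩ := hG
  let e := (K.equivFinOfCardEq hK).symm
  let q : Fin 5 → V := fun i => (e i : V)
  have hq : Function.Injective q := Subtype.val_injective.comp e.injective
  have hqa : ∀ i j, i ≠ j → G.Adj (q i) (q j) := fun i j hij =>
    hadj _ (e i).2 _ (e j).2 (hq.ne hij)
  have hp : ∀ i j, ∃ g : ℝ → ℂ, i < j → Continuous g ∧ g 0 = p (q i) ∧ g 1 = p (q j) ∧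
      ∀ t, g t ∈ A (q i) (q j) := by
    intro i j
    by_cases h : i < j
    · obtain ⟨γ, hγ⟩ := h1 _ _ (hqa i j h.ne)
      refine ⟨γ.extend, fun _ => ⟨γ.continuous_extend, γ.extend_zero, γ.extend_one, ?_⟩⟩
      intro t
      have : γ.extend t ∈ Set.range γ := by
        rw [← γ.extend_range]; exact ⟨t, rfl⟩
      obtain ⟨s, hs⟩ := this
      rw [← hs]; exact hγ s
    · exact ⟨fun _ => 0, fun h' => absurd h' h⟩
  choose g hg using hp
  refine FCT_K5 (fun i => p (q i)) g (fun i j h => (hg i j h).1) (fun i j h => (hg i j h).2.1)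
    (fun i j h => (hg i j h).2.2.1) ?_
  intro i j k l hij hkl hik hil hjk hjl s t hst
  have hd := h2 _ _ _ _ (hqa i j hij.ne) (hqa k l hkl.ne) (hq.ne hik) (hq.ne hil) (hq.ne hjk)
    (hq.ne hjl)
  exact Set.disjoint_left.1 hd ((hg i j hij).2.2.2 s) (hst ▸ (hg k l hkl).2.2.2 t)

/-- Contract `v` into `u`, keeping the vertex type. -/
def FCT_contr {V : Type*} (G : SimpleGraph V) (u v : V) : SimpleGraph V where
  Adj a b := a ≠ b ∧ a ≠ v ∧ b ≠ v ∧
    (G.Adj a b ∨ (a = u ∧ G.Adj v b) ∨ (b = u ∧ G.Adj v a))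
  symm := ⟨by
    rintro a b ⟨h1, h2, h3, h4⟩
    refine ⟨h1.symm, h3, h2, ?_⟩
    rcases h4 with h | h | h
    · exact Or.inl h.symm
    · exact Or.inr (Or.inr h)
    · exact Or.inr (Or.inl h)⟩
  loopless := ⟨fun a h => h.1 rfl⟩

lemma FCT_P_contr {V : Type*} {G : SimpleGraph V} (hG : FCT_P G) {u v : V} (huv : G.Adj u v) :
    FCT_P (FCT_contr G u v) := by
  classical
  obtain ⟨p, A, h1, h2⟩ := hG
  let A' : V → V → Set ℂ := fun a b =>
    if G.Adj a b then A a b else if a = u then A u v ∪ A v b else A u v ∪ A v a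
  refine ⟨p, A', ?_, ?_⟩
  · rintro a b ⟨hab, hav, hbv, h⟩
    by_cases h0 : G.Adj a b
    · simp only [A', if_pos h0]; exact h1 a b h0
    by_cases h3 : a = u
    · subst h3
      simp only [A', if_neg h0, if_true]
      have hvb : G.Adj v b := by
        rcases h with h | h | h
        · exact absurd h h0
        · exact h.2
        · exact absurd h.1.symm hab
      exact ((h1 _ _ huv).mono Set.subset_union_left).trans
        ((h1 _ _ hvb).mono Set.subset_union_right)
    · simp only [A', if_neg h0, if_neg h3]
      have hb : b = u ∧ G.Adj v a := by tauto
      obtain ⟨rfl, hva⟩ := hb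
      exact (((h1 _ _ huv).mono Set.subset_union_left).trans
        ((h1 _ _ hva).mono Set.subset_union_right)).symm
  · rintro a b c d ⟨hab, hav, hbv, h⟩ ⟨hcd, hcv, hdv, h'⟩ hac had hbc hbd
    by_cases h0 : G.Adj a b <;> by_cases h0' : G.Adj c d
    · simp only [A', if_pos h0, if_pos h0']; exact h2 _ _ _ _ h0 h0' hac had hbc hbd
    · simp only [A', if_pos h0, if_neg h0']
      by_cases hc : c = u
      · subst hc
        have hvd : G.Adj v d := by
          rcases h' with h | h | h
          · exact absurd h h0'
          · exact h.2
          · exact absurd h.1.symm hcd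
        simp only [if_true, Set.disjoint_union_right]
        exact ⟨h2 _ _ _ _ h0 huv hac hav hbc hbv, h2 _ _ _ _ h0 hvd hav had hbv hbd⟩
      · have hb : d = u ∧ G.Adj v c := by tauto
        obtain ⟨rfl, hvc⟩ := hb
        simp only [if_neg hc, Set.disjoint_union_right]
        exact ⟨h2 _ _ _ _ h0 huv had hav hbd hbv, h2 _ _ _ _ h0 hvc hav hac hbv hbc⟩
    · simp only [A', if_pos h0', if_neg h0]
      by_cases ha : a = u
      · subst ha
        have hvb : G.Adj v b := by
          rcases h with h | h | h
          · exact absurd h h0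
          · exact h.2
          · exact absurd h.1.symm hab
        simp only [if_true, Set.disjoint_union_left]
        exact ⟨h2 _ _ _ _ huv h0' hac had hcv.symm hdv.symm,
          h2 _ _ _ _ hvb h0' hcv.symm hdv.symm hbc hbd⟩
      · have hb : b = u ∧ G.Adj v a := by tauto
        obtain ⟨rfl, hva⟩ := hb
        simp only [if_neg ha, Set.disjoint_union_left]
        exact ⟨h2 _ _ _ _ huv h0' hbc hbd hcv.symm hdv.symm,
          h2 _ _ _ _ hva h0' hcv.symm hdv.symm hac had⟩
    · exfalso
      have e1 : a = u ∨ b = u := by tauto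
      have e2 : c = u ∨ d = u := by tauto
      rcases e1 with rfl | rfl <;> rcases e2 with rfl | rfl <;> contradiction

open Classical in
/-- Number of ordered adjacent pairs. -/
noncomputable def FCT_e {V : Type*} [Fintype V] (G : SimpleGraph V) : ℕ :=
  (Finset.univ.filter fun x : V × V => G.Adj x.1 x.2).card

open Classical in
/-- Neighbourhood. -/
noncomputable def FCT_N {V : Type*} [Fintype V] (G : SimpleGraph V) (x : V) : Finset V :=
  Finset.univ.filter fun y => G.Adj x y

lemma FCT_mem_N {V : Type*} [Fintype V] (G : SimpleGraph V) (x y : V) :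
    y ∈ FCT_N G x ↔ G.Adj x y := by simp [FCT_N]

lemma FCT_e_sum {V : Type*} [Fintype V] (G : SimpleGraph V) (S : Finset V)
    (hS : ∀ a b, G.Adj a b → a ∈ S) : FCT_e G = ∑ x ∈ S, (FCT_N G x).card := by
  classical
  rw [FCT_e, Finset.card_eq_sum_card_fiberwise (f := Prod.fst) (t := S)]
  · refine Finset.sum_congr rfl fun x _ => ?_
    refine Finset.card_bij' (fun y _ => y.2) (fun y _ => (x, y)) ?_ ?_ ?_ ?_
    · rintro ⟨a, b⟩ h; simp [FCT_N] at h ⊢; rw [← h.2]; exact h.1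
    · intro b h; simpa [FCT_N] using h
    · rintro ⟨a, b⟩ h; simp at h ⊢; exact h.2.symm
    · intro b h; rfl
  · rintro ⟨a, b⟩ h; simp at h; exact hS a b h

lemma FCT_contr_count {V : Type*} [Fintype V] [DecidableEq V] (G : SimpleGraph V) {u v : V}
    (huv : G.Adj u v) :
    FCT_e G ≤ FCT_e (FCT_contr G u v) + 2 + 2 * (FCT_N G u ∩ FCT_N G v).card := by
  classical
  let T : Finset (V × V) := Finset.univ.filter fun x : V × V => G.Adj x.1 x.2
  let R : Finset (V × V) := {(u, v), (v, u)} ∪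
    (FCT_N G u ∩ FCT_N G v).image (fun x => (v, x)) ∪
    (FCT_N G u ∩ FCT_N G v).image (fun x => (x, v))
  have hR : R.card ≤ 2 + 2 * (FCT_N G u ∩ FCT_N G v).card := by
    have a1 := Finset.card_union_le ({(u, v), (v, u)} ∪
      (FCT_N G u ∩ FCT_N G v).image (fun x => (v, x)))
      ((FCT_N G u ∩ FCT_N G v).image (fun x => (x, v)))
    have a2 := Finset.card_union_le ({(u, v), (v, u)} : Finset (V × V))
      ((FCT_N G u ∩ FCT_N G v).image (fun x => (v, x)))
    have a3 : ((FCT_N G u ∩ FCT_N G v).image (fun x => (v, x))).card ≤ _ := Finset.card_image_le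
    have a4 : ((FCT_N G u ∩ FCT_N G v).image (fun x => (x, v))).card ≤ _ := Finset.card_image_le
    have a5 : ({(u, v), (v, u)} : Finset (V × V)).card ≤ 2 := Finset.card_le_two
    show (_ ∪ _ : Finset (V × V)).card ≤ _
    omega
  have hle : (T \ R).card ≤ FCT_e (FCT_contr G u v) := by
    let r : V → V := fun a => if a = v then u else a
    have hmem : ∀ a b, (a, b) ∈ T \ R → G.Adj a b ∧ (a = v → b ≠ u ∧ ¬ G.Adj u b) ∧
        (b = v → a ≠ u ∧ ¬ G.Adj u a) := by
      intro a b h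
      simp only [T, R, Finset.mem_sdiff, Finset.mem_filter, Finset.mem_univ, true_and,
        Finset.mem_union, Finset.mem_insert, Finset.mem_singleton, Finset.mem_image,
        Finset.mem_inter, FCT_mem_N, Prod.mk.injEq, not_or, not_exists, not_and] at h
      obtain ⟨h1, ⟨⟨h2, h3⟩, h4⟩, h5⟩ := h
      refine ⟨h1, ?_, ?_⟩
      · rintro rfl
        exact ⟨fun e => h3 rfl e, fun e => h4 b ⟨e, h1⟩ rfl rfl⟩
      · rintro rfl
        exact ⟨fun e => h2 e rfl, fun e => h5 a ⟨e, h1.symm⟩ rfl rfl⟩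
    refine Finset.card_le_card_of_injOn (fun x => (r x.1, r x.2)) ?_ ?_
    · rintro ⟨a, b⟩ h
      obtain ⟨h1, h2, h3⟩ := hmem a b h
      have hne := huv.ne
      have hab := h1.ne
      simp only [Finset.coe_filter, Finset.mem_univ, true_and, Set.mem_ofPred_eq]
      by_cases ha : a = v
      · subst ha
        have hb : b ≠ a := hab.symm
        have := h2 rfl
        simp only [r, if_true, if_neg hb]
        exact ⟨this.1.symm, hne, hb, Or.inr (Or.inl ⟨rfl, h1⟩)⟩
      · by_cases hb : b = v
        · subst hb
          have := h3 rfl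
          simp only [r, if_true, if_neg ha]
          exact ⟨this.1, ha, hne, Or.inr (Or.inr ⟨rfl, h1.symm⟩)⟩
        · simp only [r, if_neg ha, if_neg hb]
          exact ⟨hab, ha, hb, Or.inl h1⟩
    · rintro ⟨a, b⟩ h ⟨c, d⟩ h' e
      obtain ⟨h1, h2, h3⟩ := hmem a b h
      obtain ⟨h1', h2', h3'⟩ := hmem c d h'
      simp only [r, Prod.mk.injEq] at e ⊢
      have s1 := h1.symm
      have s2 := h1'.symm
      have n1 := h1.ne
      have n2 := h1'.ne
      have n3 := huv.ne
      obtain ⟨e1, e2⟩ := e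
      split_ifs at e1 e2 <;> grind
  have := Finset.le_card_sdiff R T
  have hT : FCT_e G = T.card := rfl
  omega

lemma FCT_delete_edge_count {V : Type*} [Fintype V] (G : SimpleGraph V) {u v : V}
    (huv : G.Adj u v) : FCT_e (G.deleteEdges {s(u, v)}) < FCT_e G ∧
      FCT_e G ≤ FCT_e (G.deleteEdges {s(u, v)}) + 2 := by
  classical
  constructor
  · refine Finset.card_lt_card ?_
    rw [Finset.ssubset_iff_of_subset]
    · exact ⟨(u, v), by simpa using huv, by simp⟩
    · intro x; simp; tauto
  · have : (Finset.univ.filter fun x : V × V => G.Adj x.1 x.2) ⊆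
      (Finset.univ.filter fun x : V × V => (G.deleteEdges {s(u, v)}).Adj x.1 x.2) ∪
        {(u, v), (v, u)} := by
      rintro ⟨a, b⟩ h
      simp at h ⊢
      tauto
    have h1 := Finset.card_le_card this
    have h2 := Finset.card_union_le (Finset.univ.filter fun x : V × V =>
      (G.deleteEdges {s(u, v)}).Adj x.1 x.2) {(u, v), (v, u)}
    have h3 : ({(u, v), (v, u)} : Finset (V × V)).card ≤ 2 := Finset.card_le_two
    have h4 : FCT_e G ≤ _ := h1
    have h5 : FCT_e (G.deleteEdges {s(u, v)}) = (Finset.univ.filter fun x : V × V =>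
        (G.deleteEdges {s(u, v)}).Adj x.1 x.2).card := by
      unfold FCT_e
      refine congrArg Finset.card (Finset.ext fun x => ?_)
      simp only [Finset.mem_filter]
    omega

lemma FCT_edge_bound {V : Type*} [Fintype V] : ∀ (n m : ℕ) (S : Finset V) (G : SimpleGraph V),
    S.card = n → FCT_e G = m → 3 ≤ S.card → (∀ a b, G.Adj a b → a ∈ S) → FCT_P G →
    FCT_e G + 10 < 6 * S.card := by
  classical
  intro n
  induction n using Nat.strong_induction_on with
  | _ n ihn =>
  intro m
  induction m using Nat.strong_induction_on with
  | _ m ihm =>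
  intro S G hn hm hS3 hS hP
  by_contra hcon
  rw [not_lt] at hcon
  have hsum := FCT_e_sum G S hS
  have hNS : ∀ x, FCT_N G x ⊆ S.erase x := by
    intro x y hy
    rw [FCT_mem_N] at hy
    exact Finset.mem_erase.2 ⟨hy.ne.symm, hS _ _ hy.symm⟩
  -- at least four vertices
  have hS4 : 4 ≤ S.card := by
    by_contra h
    have h3 : S.card = 3 := by omega
    have : ∑ x ∈ S, (FCT_N G x).card ≤ S.card • 2 := by
      refine Finset.sum_le_card_nsmul _ _ _ fun x hx => ?_
      have := Finset.card_le_card (hNS x)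
      rw [Finset.card_erase_of_mem hx] at this
      omega
    rw [← hsum, h3] at this
    simp at this
    omega
  -- we may delete edges
  by_cases hbig : 6 * S.card ≤ FCT_e G + 8
  · have : ∃ x ∈ S, (FCT_N G x).card ≠ 0 := by
      by_contra! h
      rw [Finset.sum_eq_zero h] at hsum
      omega
    obtain ⟨x, hx, hx0⟩ := this
    obtain ⟨y, hy⟩ := Finset.card_pos.1 (Nat.pos_of_ne_zero hx0)
    rw [FCT_mem_N] at hy
    have hc := FCT_delete_edge_count G hy
    have := ihm _ (by omega) S (G.deleteEdges {s(x, y)}) hn rfl hS3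
      (fun a b h => hS a b (G.deleteEdges_le _ h)) (FCT_P_mono (G.deleteEdges_le _) hP)
    omega
  -- low degree vertex
  obtain ⟨x, hx, hx5⟩ : ∃ x ∈ S, (FCT_N G x).card < 6 := by
    refine Finset.exists_lt_of_sum_lt (g := fun _ => 6) ?_
    rw [← hsum]; simp; omega
  by_cases hx0 : (FCT_N G x).card = 0
  · have hN0 := Finset.card_eq_zero.1 hx0
    have hno : ∀ b, ¬ G.Adj x b := by
      intro b hb
      rw [← FCT_mem_N, hN0] at hb
      simp at hb
    have hc := Finset.card_erase_of_mem hx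
    have := ihn _ (by omega) _ (S.erase x) G rfl rfl (by omega)
      (fun a b h => Finset.mem_erase.2 ⟨fun e => hno b (e ▸ h), hS a b h⟩) hP
    omega
  -- every edge lies in at least three triangles
  have tri : ∀ u v, G.Adj u v → 3 ≤ (FCT_N G u ∩ FCT_N G v).card := by
    intro u v huv
    by_contra h
    have hcount := FCT_contr_count G huv
    have hc := Finset.card_erase_of_mem (hS v u huv.symm)
    have := ihn _ (by omega) _ (S.erase v) (FCT_contr G u v) rfl rfl (by omega)
      (by
        rintro a b ⟨h1, h2, h3, h4⟩
        refine Finset.mem_erase.2 ⟨h2, ?_⟩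
        rcases h4 with h | h | h
        · exact hS _ _ h
        · rw [h.1]; exact hS _ _ huv
        · exact hS _ _ h.2.symm) (FCT_P_contr hP huv)
    omega
  set N := FCT_N G x with hN
  have hxN : x ∉ N := by rw [hN, FCT_mem_N]; exact G.loopless.irrefl x
  have hdeg : ∀ y ∈ N, ∀ B ⊆ N, (∀ w ∈ B, ¬ G.Adj y w) → B.card + 3 ≤ N.card := by
    intro y hy B hB hBy
    have h3 : 3 ≤ (N ∩ FCT_N G y).card := tri x y ((FCT_mem_N _ _ _).1 hy)
    have hd : Disjoint B (N ∩ FCT_N G y) := by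
      rw [Finset.disjoint_left]
      intro w hw hw'
      exact hBy w hw ((FCT_mem_N _ _ _).1 (Finset.mem_inter.1 hw').2)
    have := Finset.card_le_card (Finset.union_subset hB (Finset.inter_subset_left
      (s₁ := N) (s₂ := FCT_N G y)))
    rw [Finset.card_union_of_disjoint hd] at this
    omega
  obtain ⟨y0, hy0⟩ := Finset.card_pos.1 (Nat.pos_of_ne_zero hx0)
  have h4 := hdeg y0 hy0 {y0} (by simpa using hy0) (by simp)
  rw [Finset.card_singleton] at h4
  have hxa : ∀ y ∈ N, G.Adj x y := fun y hy => (FCT_mem_N _ _ _).1 hy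
  by_cases hN4 : N.card = 4
  · refine FCT_no_K5 hP (insert x N) (by rw [Finset.card_insert_of_notMem hxN, hN4]) ?_
    have hcl : ∀ a ∈ N, ∀ b ∈ N, a ≠ b → G.Adj a b := by
      intro a ha b hb hab
      by_contra hn
      have := hdeg a ha {a, b} (by intro t; simp; rintro (rfl | rfl) <;> assumption)
        (by simp [hn])
      rw [Finset.card_pair hab] at this
      omega
    intro a ha b hb hab
    rcases Finset.mem_insert.1 ha with rfl | ha <;> rcases Finset.mem_insert.1 hb with rfl | hb
    · exact absurd rfl hab
    · exact hxa _ hb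
    · exact (hxa _ ha).symm
    · exact hcl a ha b hb hab
  have hN5 : N.card = 5 := by omega
  have huniq : ∀ y ∈ N, ∀ w ∈ N, ∀ w' ∈ N, y ≠ w → y ≠ w' → ¬ G.Adj y w → ¬ G.Adj y w' →
      w = w' := by
    intro y hy w hw w' hw' h1 h2 h3 h4
    by_contra hne
    have := hdeg y hy {y, w, w'}
      (by intro t; simp; rintro (rfl | rfl | rfl) <;> assumption) (by simp [h3, h4])
    rw [Finset.card_eq_three.2 ⟨y, w, w', h1, h2, hne, rfl⟩] at this
    omega
  by_cases hcl : ∀ a ∈ N, ∀ b ∈ N, a ≠ b → G.Adj a b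
  · exact FCT_no_K5 hP N hN5 hcl
  push Not at hcl
  obtain ⟨b, hb, c, hc, hbc, hnbc⟩ := hcl
  have hd : ∃ d ∈ N, d ≠ b ∧ d ≠ c ∧ ∀ y ∈ N, ∀ w ∈ N, y ≠ b → y ≠ c → w ≠ b → w ≠ c → y ≠ w →
      ¬ G.Adj y w → y = d ∨ w = d := by
    by_cases hex : ∃ d ∈ N, ∃ e ∈ N, d ≠ b ∧ d ≠ c ∧ e ≠ b ∧ e ≠ c ∧ d ≠ e ∧ ¬ G.Adj d e
    · obtain ⟨d, hd, e, he, h1, h2, h3, h4, h5, h6⟩ := hex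
      refine ⟨d, hd, h1, h2, ?_⟩
      intro y hy w hw k1 k2 k3 k4 k5 k6
      by_contra! hcon
      by_cases hye : y = e
      · subst hye
        exact hcon.2 (huniq y hy w hw d hd k5 h5.symm k6 (fun h => h6 h.symm))
      · by_cases hwe : w = e
        · subst hwe
          exact hcon.1 (huniq w hw y hy d hd k5.symm h5.symm (fun h => k6 h.symm)
            (fun h => h6 h.symm))
        · have hsub : ({b, c, d, e, y, w} : Finset V) ⊆ N := by
            intro t; simp; rintro (rfl | rfl | rfl | rfl | rfl | rfl) <;> assumption
          have hcard : ({b, c, d, e, y, w} : Finset V).card = 6 := by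
            have := hcon.1.symm
            have := hcon.2.symm
            have := h1.symm
            have := h2.symm
            have := h3.symm
            have := h4.symm
            have := k1.symm
            have := k2.symm
            have := k3.symm
            have := k4.symm
            have := Ne.symm hye
            have := Ne.symm hwe
            simp [Finset.card_insert_of_notMem, *]
          have := Finset.card_le_card hsub
          omega
    · push Not at hex
      have : 0 < (N \ {b, c}).card := by
        have := Finset.le_card_sdiff {b, c} N
        rw [Finset.card_pair hbc] at this
        omega
      obtain ⟨d, hd⟩ := Finset.card_pos.1 this
      simp at hd
      exact ⟨d, hd.1, hd.2.1, hd.2.2, fun y hy w hw k1 k2 k3 k4 k5 k6 =>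
        absurd (hex y hy w hw k1 k2 k3 k4 k5) k6⟩
  obtain ⟨d, hdN, hdb, hdc, hd⟩ := hd
  have hbadj : ∀ y ∈ N, y ≠ b → y ≠ c → G.Adj b y := by
    intro y hy h1 h2
    by_contra h
    exact h2 (huniq b hb y hy c hc h1.symm hbc h hnbc)
  have hcadj : ∀ y ∈ N, y ≠ b → y ≠ c → G.Adj c y := by
    intro y hy h1 h2
    by_contra h
    exact h1 (huniq c hc y hy b hb h2.symm hbc.symm h (fun h => hnbc h.symm))
  have hP' := FCT_P_contr hP (hbadj d hdN hdb hdc).symm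
  have hxb : x ≠ b := fun e => hxN (e ▸ hb)
  refine FCT_no_K5 hP' (insert x (N.erase b)) ?_ ?_
  · rw [Finset.card_insert_of_notMem (fun h => hxN (Finset.mem_of_mem_erase h)),
      Finset.card_erase_of_mem hb, hN5]
  intro a ha a' ha' haa
  rcases Finset.mem_insert.1 ha with rfl | ha <;> rcases Finset.mem_insert.1 ha' with rfl | ha'
  · exact absurd rfl haa
  · have ha' := Finset.mem_erase.1 ha'
    exact ⟨haa, hxb, ha'.1, Or.inl (hxa _ ha'.2)⟩
  · have ha := Finset.mem_erase.1 ha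
    exact ⟨haa, ha.1, hxb, Or.inl (hxa _ ha.2).symm⟩
  · have ha := Finset.mem_erase.1 ha
    have ha' := Finset.mem_erase.1 ha'
    refine ⟨haa, ha.1, ha'.1, ?_⟩
    by_cases hadj : G.Adj a a'
    · exact Or.inl hadj
    · have n1 : a ≠ c := fun e => hadj (e ▸ hcadj a' ha'.2 ha'.1 (fun e' => haa (e.trans e'.symm)))
      have n2 : a' ≠ c := fun e => hadj (e ▸ hcadj a ha.2 ha.1 n1).symm
      rcases hd a ha.2 a' ha'.2 ha.1 n1 ha'.1 n2 haa hadj with e | e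
      · exact Or.inr (Or.inl ⟨e, hbadj a' ha'.2 ha'.1 n2⟩)
      · exact Or.inr (Or.inr ⟨e, hbadj a ha.2 ha.1 n1⟩)

lemma FCT_low_degree {V : Type*} [Fintype V] (S : Finset V) (hne : S.Nonempty)
    (G : SimpleGraph V) (hS : ∀ a b, G.Adj a b → a ∈ S) (hP : FCT_P G) :
    ∃ x ∈ S, (FCT_N G x).card < 6 := by
  by_cases h : 3 ≤ S.card
  · have hb := FCT_edge_bound _ _ S G rfl rfl h hS hP
    refine Finset.exists_lt_of_sum_lt (g := fun _ => 6) ?_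
    rw [← FCT_e_sum G S hS]; simp; omega
  · obtain ⟨x, hx⟩ := hne
    refine ⟨x, hx, ?_⟩
    have : FCT_N G x ⊆ S := fun y hy => hS _ _ ((FCT_mem_N _ _ _).1 hy).symm
    have := Finset.card_le_card this
    omega

lemma FCT_recolour {V : Type*} [Fintype V] (G : SimpleGraph V) (x : V) (c : V → Fin 5)
    (hc : ∀ a b, a ≠ x → b ≠ x → G.Adj a b → c a ≠ c b)
    (hN : ((FCT_N G x).image c).card < 5) : G.Colorable 5 := by
  classical
  obtain ⟨k, hk⟩ : ∃ k, k ∉ (FCT_N G x).image c := by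
    by_contra! h
    rw [Finset.eq_univ_iff_forall.2 h] at hN
    simp at hN
  have hk' : ∀ b, G.Adj x b → c b ≠ k := fun b hb e =>
    hk (Finset.mem_image.2 ⟨b, (FCT_mem_N _ _ _).2 hb, e⟩)
  refine ⟨SimpleGraph.Coloring.mk (fun a => if a = x then k else c a) ?_⟩
  intro a b hab
  by_cases ha : a = x <;> by_cases hb : b = x
  · exact absurd (ha.trans hb.symm) hab.ne
  · simp only [if_pos ha, if_neg hb]; exact (hk' b (ha ▸ hab)).symm
  · simp only [if_neg ha, if_pos hb]; exact hk' a (hb ▸ hab.symm)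
  · simp only [if_neg ha, if_neg hb]; exact hc a b ha hb hab

lemma FCT_main {V : Type*} [Fintype V] : ∀ (m : ℕ) (S : Finset V) (G : SimpleGraph V),
    S.card = m → (∀ a b, G.Adj a b → a ∈ S) → FCT_P G → G.Colorable 5 := by
  classical
  intro m
  induction m using Nat.strong_induction_on with
  | _ m ih =>
  intro S G hm hS hP
  rcases S.eq_empty_or_nonempty with rfl | hne
  · exact ⟨SimpleGraph.Coloring.mk (fun _ => 0) fun {a b} h => absurd (hS a b h) (by simp)⟩
  obtain ⟨x, hx, hx6⟩ := FCT_low_degree S hne G hS hP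
  have hcx := Finset.card_erase_of_mem hx
  have hpos := Finset.card_pos.2 hne
  by_cases h4 : (FCT_N G x).card < 5
  · obtain ⟨c⟩ := ih _ (by omega) (S.erase x) (G.deleteIncidenceSet x) rfl
      (by
        intro a b h
        rw [SimpleGraph.deleteIncidenceSet_adj] at h
        exact Finset.mem_erase.2 ⟨h.2.1, hS _ _ h.1⟩)
      (FCT_P_mono (G.deleteIncidenceSet_le x) hP)
    refine FCT_recolour G x c ?_ (lt_of_le_of_lt Finset.card_image_le h4)
    intro a b ha hb hab
    exact c.valid (SimpleGraph.deleteIncidenceSet_adj.2 ⟨hab, ha, hb⟩)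
  by_cases hcl : ∀ a ∈ FCT_N G x, ∀ b ∈ FCT_N G x, a ≠ b → G.Adj a b
  · exact (FCT_no_K5 hP _ (by omega) hcl).elim
  push Not at hcl
  obtain ⟨y, hy, z, hz, hyz, hnyz⟩ := hcl
  have hxy := (FCT_mem_N _ _ _).1 hy
  have hxz := (FCT_mem_N _ _ _).1 hz
  have hP1 := FCT_P_contr hP hxy.symm
  have h1yz : (FCT_contr G y x).Adj y z :=
    ⟨hyz, hxy.ne.symm, hxz.ne.symm, Or.inr (Or.inl ⟨rfl, hxz⟩)⟩
  have hP2 := FCT_P_contr hP1 h1yz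
  obtain ⟨c⟩ := ih _ (by omega) (S.erase x) (FCT_contr (FCT_contr G y x) y z) rfl
      (by
        have hyS := hS _ _ hxy.symm
        have k1 : ∀ a b, (FCT_contr G y x).Adj a b → a ∈ S.erase x := by
          rintro a b ⟨h1, h2, h3, h4⟩
          refine Finset.mem_erase.2 ⟨h2, ?_⟩
          rcases h4 with h | h | h
          · exact hS _ _ h
          · rw [h.1]; exact hyS
          · exact hS _ _ h.2.symm
        rintro a b ⟨h1, h2, h3, h4⟩
        rcases h4 with h | h | h
        · exact k1 _ _ h
        · rw [h.1]; exact k1 _ _ h1yz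
        · exact k1 _ _ h.2.symm) hP2
  have c1 : ∀ a b, a ≠ x → b ≠ x → a ≠ z → b ≠ z → G.Adj a b → c a ≠ c b := by
    intro a b h1 h2 h3 h4 hab
    exact c.valid ⟨hab.ne, h3, h4, Or.inl ⟨hab.ne, h1, h2, Or.inl hab⟩⟩
  have c2 : ∀ b, b ≠ x → G.Adj z b → c y ≠ c b := by
    intro b h1 hzb
    have hby : b ≠ y := fun e => hnyz (e ▸ hzb).symm
    exact c.valid ⟨hby.symm, hyz, hzb.ne.symm,
      Or.inr (Or.inl ⟨rfl, hzb.ne, hxz.ne.symm, h1, Or.inl hzb⟩)⟩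
  refine FCT_recolour G x (fun a => if a = z then c y else c a) ?_ ?_
  · intro a b ha hb hab
    by_cases haz : a = z <;> by_cases hbz : b = z
    · exact absurd (haz.trans hbz.symm) hab.ne
    · simp only [if_pos haz, if_neg hbz]; exact c2 b hb (haz ▸ hab)
    · simp only [if_neg haz, if_pos hbz]; exact (c2 a ha (hbz ▸ hab.symm)).symm
    · simp only [if_neg haz, if_neg hbz]; exact c1 a b ha hb haz hbz hab
  · have : (FCT_N G x).image (fun a => if a = z then c y else c a) ⊆
        ((FCT_N G x).erase z).image c := by
      intro k hk
      obtain ⟨a, ha, rfl⟩ := Finset.mem_image.1 hk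
      by_cases haz : a = z
      · simp only [if_pos haz]
        exact Finset.mem_image_of_mem _ (Finset.mem_erase.2 ⟨hyz, hy⟩)
      · simp only [if_neg haz]
        exact Finset.mem_image_of_mem _ (Finset.mem_erase.2 ⟨haz, ha⟩)
    have h1 := Finset.card_le_card this
    have h2 : (((FCT_N G x).erase z).image c).card ≤ _ := Finset.card_image_le
    rw [Finset.card_erase_of_mem hz] at h2
    omega

/-- The Five Colour Theorem: every finite simple planar graph admits a proper
vertex colouring with 5 colours. -/
theorem five_colour_theorem {V : Type*} [Fintype V] (G : SimpleGraph V)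
    (hG : G.IsPlanar) : G.Colorable 5 := by
  exact FCT_main _ Finset.univ G rfl (fun _ _ _ => Finset.mem_univ _) (FCT_P_of_planar G hG)
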